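/- There are no rational numbers a, z₁, z₂, z₃ with a ≠ 0, z₁, z₂, z₃ pairwise distinct, and z₁³ + a = a·z₁²·z₂, z₂³ + a = a·z₂²·z₃, z₃³ + a = a·z₃²·z₁. Equivalently, for no parameter a ∈ ℚ \ {0} does the map f_a(z) = (z³ + a)/(a·z²) have a ℚ-rational periodic point of minimal period 3. -/

import Mathlib

/-- Eliminating `a` from the equations of a 3-cycle leaves a sum of three squares. -/
lemma sum_sq_eq_zero_of_three_cycle {K : Type*} [Field K] {a x y z : K} (ha : a ≠ 0)
    (hx : x ^ 3 + a = a * x ^ 2 * y) (hy : y ^ 3 + a = a * y ^ 2 * z)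
    (hz : z ^ 3 + a = a * z ^ 2 * x) :
    (x * y ^ 2 - y * z ^ 2) ^ 2 + (y * z ^ 2 - z * x ^ 2) ^ 2 +
      (z * x ^ 2 - x * y ^ 2) ^ 2 = 0 := by
  refine (mul_eq_zero.mp ?_).resolve_left ha
  linear_combination
    -2 * (y ^ 3 - z ^ 3) * hx - 2 * (z ^ 3 - x ^ 3) * hy - 2 * (x ^ 3 - y ^ 3) * hz

/-- There are no rationals `a, z₁, z₂, z₃` with `a ≠ 0`, the `zᵢ` pairwise distinct,
and `zᵢ³ + a = a·zᵢ²·z_{i+1}` cyclically; i.e. no member of the family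
`f_a(z) = (z³ + a)/(a z²)` has a ℚ-rational point of minimal period 3. -/
theorem A3C3_no_rational_three_cycle :
    ¬ ∃ a z₁ z₂ z₃ : ℚ, a ≠ 0 ∧ z₁ ≠ z₂ ∧ z₁ ≠ z₃ ∧ z₂ ≠ z₃ ∧
      z₁ ^ 3 + a = a * z₁ ^ 2 * z₂ ∧
      z₂ ^ 3 + a = a * z₂ ^ 2 * z₃ ∧
      z₃ ^ 3 + a = a * z₃ ^ 2 * z₁ := by
  rintro ⟨a, x, y, z, ha, -, hxz, -, hx, hy, hz⟩
  have hsum := sum_sq_eq_zero_of_three_cycle ha hx hy hz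
  have hPQ : x * y ^ 2 - y * z ^ 2 = 0 := by
    apply pow_eq_zero_iff two_ne_zero |>.mp
    nlinarith [sq_nonneg (x * y ^ 2 - y * z ^ 2), sq_nonneg (y * z ^ 2 - z * x ^ 2),
      sq_nonneg (z * x ^ 2 - x * y ^ 2)]
  have hQR : y * z ^ 2 - z * x ^ 2 = 0 := by
    apply pow_eq_zero_iff two_ne_zero |>.mp
    nlinarith [sq_nonneg (x * y ^ 2 - y * z ^ 2), sq_nonneg (y * z ^ 2 - z * x ^ 2),
      sq_nonneg (z * x ^ 2 - x * y ^ 2)]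
  have hy0 : y ≠ 0 := by
    rintro rfl
    exact ha (by linear_combination hy)
  have hz0 : z ≠ 0 := by
    rintro rfl
    exact ha (by linear_combination hz)
  have hxy : x * y = z ^ 2 := mul_left_cancel₀ hy0 (by linear_combination hPQ)
  have hyz : y * z = x ^ 2 := mul_left_cancel₀ hz0 (by linear_combination hQR)
  have hcube : x ^ 3 = z ^ 3 := by linear_combination z * hxy - x * hyz
  exact hxz ((Odd.strictMono_pow (by decide : Odd 3)).injective hcube)
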